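/- Let U_{(i)} be the i-th order statistic of n i.i.d. uniform random variables on [0,1], so U_{(i)} ~ Beta(i, n+1−i). For i ≤ n−3, E[ (U_{(i)} − i/(n+1))² / (1 − U_{(i)})^{5/2} ] = (B(i, n−i−3/2)/B(i, n+1−i)) · E_n^i, where E_n^i = i(i+1)/((n−1/2)(n+1/2)) − 2·(i/(n+1))·i/( (n−1/2)(n+1/2) )·(i+1) + (i/(n+1))²-type expansion; in particular this expectation is finite and asymptotically equivalent to n^{-1} (i/(n+1)) (1 − i/(n+1))^{−3/2} as n → ∞ with i = ⌊nβ⌋, β < 1. -/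

import Mathlib

open MeasureTheory Filter Asymptotics

/-- The Beta function `B(a,b) = ∫₀¹ t^{a-1}(1-t)^{b-1} dt`. -/
noncomputable def betaFun (a b : ℝ) : ℝ :=
  ∫ t in Set.Ioo (0:ℝ) 1, t ^ (a - 1) * (1 - t) ^ (b - 1)

/-- `E[(U_{(i)} - i/(n+1))²/(1-U_{(i)})^{5/2}]` for `U_{(i)} ~ Beta(i, n+1-i)`. -/
noncomputable def orderStatMoment (i n : ℕ) : ℝ :=
  (∫ x in Set.Ioo (0:ℝ) 1,
      x ^ ((i : ℝ) - 1) * (1 - x) ^ ((n : ℝ) - i) *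
        (x - (i : ℝ) / ((n : ℝ) + 1)) ^ 2 / (1 - x) ^ ((5 : ℝ) / 2)) /
    betaFun i ((n : ℝ) + 1 - i)

open Topology in
lemma aux_equiv {f g : ℕ → ℝ} {c : ℝ} (hc : c ≠ 0)
    (hf : Tendsto (fun n : ℕ => (n : ℝ) * f n) atTop (𝓝 c))
    (hg : Tendsto (fun n : ℕ => (n : ℝ) * g n) atTop (𝓝 c)) : f ~[atTop] g := by
  have hgn : ∀ᶠ n : ℕ in atTop, (n : ℝ) * g n ≠ 0 := hg.eventually_ne hc
  rw [isEquivalent_iff_tendsto_one (hgn.mono fun n h => right_ne_zero_of_mul h)]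
  have := hf.div hg hc
  rw [div_self hc] at this
  refine this.congr' (hgn.mono fun n h => ?_)
  simp only [Pi.div_apply]
  rw [mul_div_mul_left _ _ (left_ne_zero_of_mul h)]

lemma aux_ofReal {a b x : ℝ} (hx : x ∈ Set.Ioo (0:ℝ) 1) :
    (x : ℂ) ^ ((a : ℂ) - 1) * (1 - (x : ℂ)) ^ ((b : ℂ) - 1) =
      ((x ^ (a - 1) * (1 - x) ^ (b - 1) : ℝ) : ℂ) := by
  rw [Complex.ofReal_mul, Complex.ofReal_cpow hx.1.le, Complex.ofReal_cpow (by linarith [hx.2])]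
  push_cast
  rfl

lemma aux_integrable {a b : ℝ} (ha : 0 < a) (hb : 0 < b) :
    IntegrableOn (fun t : ℝ => t ^ (a - 1) * (1 - t) ^ (b - 1)) (Set.Ioo 0 1) volume := by
  have h := Complex.betaIntegral_convergent (u := a) (v := b) (by simpa) (by simpa)
  rw [intervalIntegrable_iff_integrableOn_Ioo_of_le zero_le_one] at h
  have h2 := h.re
  refine (integrableOn_congr_fun (fun x hx => ?_) measurableSet_Ioo).1 h2
  simp only [aux_ofReal hx]
  simp

lemma aux_beta {a b : ℝ} (ha : 0 < a) (hb : 0 < b) :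
    betaFun a b = Real.Gamma a * Real.Gamma b / Real.Gamma (a + b) := by
  have h := ProbabilityTheory.beta_eq_betaIntegralReal a b ha hb
  rw [ProbabilityTheory.beta] at h
  rw [h, Complex.betaIntegral, intervalIntegral.integral_of_le zero_le_one,
    ← integral_Ioc_eq_integral_Ioo.symm, betaFun]
  rw [setIntegral_congr_fun measurableSet_Ioo (fun x hx => aux_ofReal hx), integral_complex_ofReal]
  simp

lemma aux_split {i n p x : ℝ} (hx : x ∈ Set.Ioo (0:ℝ) 1) :
    x ^ ((i + 2) - 1) * (1 - x) ^ ((n - i - 3 / 2) - 1)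
      - 2 * p * (x ^ ((i + 1) - 1) * (1 - x) ^ ((n - i - 3 / 2) - 1))
      + p ^ 2 * (x ^ (i - 1) * (1 - x) ^ ((n - i - 3 / 2) - 1)) =
    x ^ (i - 1) * (1 - x) ^ (n - i) * (x - p) ^ 2 / (1 - x) ^ ((5 : ℝ) / 2) := by
  have h1 : 0 < 1 - x := by linarith [hx.2]
  have e1 : x ^ ((i + 2) - 1) = x ^ (i - 1) * x ^ 2 := by
    rw [← Real.rpow_natCast x 2, ← Real.rpow_add hx.1]; congr 1; push_cast; ring
  have e2 : x ^ ((i + 1) - 1) = x ^ (i - 1) * x := by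
    rw [← Real.rpow_add_one hx.1.ne']; congr 1; ring
  have e3 : (1 - x) ^ ((n - i - 3 / 2) - 1) = (1 - x) ^ (n - i) / (1 - x) ^ ((5 : ℝ) / 2) := by
    rw [← Real.rpow_sub h1]; congr 1; ring
  rw [e1, e2, e3]; ring

lemma aux_int {i n : ℝ} (p : ℝ) (hi : 0 < i) (hn : 0 < n - i - 3 / 2) :
    IntegrableOn (fun x : ℝ =>
      x ^ (i - 1) * (1 - x) ^ (n - i) * (x - p) ^ 2 / (1 - x) ^ ((5 : ℝ) / 2))
      (Set.Ioo 0 1) volume ∧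
    ∫ x in Set.Ioo (0:ℝ) 1,
      x ^ (i - 1) * (1 - x) ^ (n - i) * (x - p) ^ 2 / (1 - x) ^ ((5 : ℝ) / 2) =
      betaFun (i + 2) (n - i - 3 / 2) - 2 * p * betaFun (i + 1) (n - i - 3 / 2)
        + p ^ 2 * betaFun i (n - i - 3 / 2) := by
  have h2 := aux_integrable (a := i + 2) (b := n - i - 3 / 2) (by linarith) hn
  have h1 := (aux_integrable (a := i + 1) (b := n - i - 3 / 2) (by linarith) hn).const_mul (2 * p)
  have h0 := (aux_integrable (a := i) (b := n - i - 3 / 2) hi hn).const_mul (p ^ 2)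
  constructor
  · refine (integrableOn_congr_fun (fun x hx => ?_) measurableSet_Ioo).1 ((h2.sub h1).add h0)
    exact aux_split hx
  · rw [← setIntegral_congr_fun measurableSet_Ioo (fun x hx => aux_split (n := n) (i := i) hx)]
    have e := integral_add (h2.sub h1) h0
    simp only [Pi.sub_apply] at e
    rw [e, integral_sub h2 h1, integral_const_mul, integral_const_mul]
    rfl

lemma aux_half {x : ℝ} (hx : 0 < x) :
    Real.Gamma (x + 1 / 2) ^ 2 ≤ Real.Gamma x * Real.Gamma (x + 1) := by
  have h := Real.Gamma_mul_add_mul_le_rpow_Gamma_mul_rpow_Gamma hx (by linarith : 0 < x + 1)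
    (a := 1 / 2) (b := 1 / 2) (by norm_num) (by norm_num) (by norm_num)
  have e : 1 / 2 * x + 1 / 2 * (x + 1) = x + 1 / 2 := by ring
  rw [e, ← Real.sqrt_eq_rpow, ← Real.sqrt_eq_rpow] at h
  have g0 := (Real.Gamma_pos_of_pos hx).le
  have g1 := (Real.Gamma_pos_of_pos (by linarith : 0 < x + 1)).le
  have g2 := (Real.Gamma_pos_of_pos (by linarith : 0 < x + 1 / 2)).le
  calc _ ≤ _ := pow_le_pow_left₀ g2 h 2
    _ = _ := by rw [mul_pow, Real.sq_sqrt g0, Real.sq_sqrt g1]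

open Topology in
lemma aux_lin (c : ℝ) : Tendsto (fun x : ℝ => (x + c) / x) atTop (𝓝 1) := by
  have h : Tendsto (fun x : ℝ => 1 + c * x⁻¹) atTop (𝓝 (1 + c * 0)) :=
    tendsto_const_nhds.add (tendsto_inv_atTop_zero.const_mul c)
  rw [mul_zero, add_zero] at h
  refine h.congr' ?_
  filter_upwards [eventually_gt_atTop 0] with x hx
  field_simp

open Topology in
lemma aux_H : Tendsto (fun x : ℝ => Real.Gamma (x + 5 / 2) / Real.Gamma x / x ^ ((5 : ℝ) / 2))
    atTop (𝓝 1) := by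
  have hsq : Tendsto (fun x : ℝ => (Real.Gamma (x + 1 / 2) / Real.Gamma x) ^ 2 / x)
      atTop (𝓝 1) := by
    have hl : Tendsto (fun x : ℝ => ((x + 1 / 2) / x)⁻¹) atTop (𝓝 1) := by
      simpa using (aux_lin (1 / 2)).inv₀ one_ne_zero
    refine tendsto_of_tendsto_of_tendsto_of_le_of_le' hl tendsto_const_nhds ?_ ?_
    · filter_upwards [eventually_gt_atTop 0] with x hx
      have h := aux_half (x := x + 1 / 2) (by linarith)
      have e : x + 1 / 2 + 1 / 2 = x + 1 := by ring
      rw [e, Real.Gamma_add_one hx.ne', Real.Gamma_add_one (by linarith)] at h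
      have g := Real.Gamma_pos_of_pos hx
      rw [inv_div, div_pow, div_div, div_le_div_iff₀ (by linarith) (by positivity)]
      nlinarith
    · filter_upwards [eventually_gt_atTop 0] with x hx
      have h := aux_half hx
      rw [Real.Gamma_add_one hx.ne'] at h
      have g := Real.Gamma_pos_of_pos hx
      rw [div_pow, div_div, div_le_one (by positivity)]
      nlinarith
  have h1 := ((aux_lin (3 / 2)).mul (aux_lin (1 / 2))).mul hsq.sqrt
  simp only [mul_one, Real.sqrt_one] at h1
  refine h1.congr' ?_
  filter_upwards [eventually_gt_atTop 0] with x hx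
  have g := Real.Gamma_pos_of_pos hx
  have g2 := Real.Gamma_pos_of_pos (by linarith : 0 < x + 1 / 2)
  have e1 : Real.Gamma (x + 5 / 2) = (x + 3 / 2) * ((x + 1 / 2) * Real.Gamma (x + 1 / 2)) := by
    rw [← Real.Gamma_add_one (by linarith), (by ring : x + 1 / 2 + 1 = x + 3 / 2),
      ← Real.Gamma_add_one (by linarith)]
    congr 1; ring
  have e2 : x ^ ((5 : ℝ) / 2) = x ^ 2 * √x := by
    rw [Real.sqrt_eq_rpow, ← Real.rpow_natCast x 2, ← Real.rpow_add hx]; congr 1; norm_num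
  rw [e1, e2, Real.sqrt_div (by positivity), Real.sqrt_sq (by positivity)]
  have := Real.sqrt_pos.2 hx
  field_simp

lemma aux_formula {i n b s : ℝ} (hi : 0 < i) (hb : 0 < b) (hs : s = i + b)
    (hn : n = s + 3 / 2) :
    n * ((betaFun (i + 2) b - 2 * (i / (n + 1)) * betaFun (i + 1) b
        + (i / (n + 1)) ^ 2 * betaFun i b) / betaFun i (b + 5 / 2)) =
    (Real.Gamma (s + 5 / 2) / Real.Gamma s / s ^ ((5 : ℝ) / 2)) /
      (Real.Gamma (b + 5 / 2) / Real.Gamma b / b ^ ((5 : ℝ) / 2)) * ((b / s) ^ ((5 : ℝ) / 2))⁻¹ *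
      (n / (s + 1) * (i / s) * (b / s) + 25 / 4 * (i / s) ^ 2 * (n / (n + 1)) * (1 / (n + 1))) := by
  have hs0 : 0 < s := by linarith
  rw [aux_beta (by linarith) hb, aux_beta (by linarith) hb, aux_beta hi hb,
    aux_beta hi (by linarith), Real.div_rpow hb.le hs0.le]
  have a1 : i + 2 + b = s + 1 + 1 := by linarith
  have a2 : i + 1 + b = s + 1 := by linarith
  have a3 : i + (b + 5 / 2) = s + 5 / 2 := by linarith
  have a4 : i + 2 = i + 1 + 1 := by linarith
  rw [a1, a2, a3, a4, ← hs, Real.Gamma_add_one (s := s + 1) (by linarith),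
    Real.Gamma_add_one (s := s) (by linarith), Real.Gamma_add_one (s := i + 1) (by linarith),
    Real.Gamma_add_one (s := i) (by linarith)]
  have g1 := Real.Gamma_pos_of_pos hi
  have g2 := Real.Gamma_pos_of_pos hb
  have g3 := Real.Gamma_pos_of_pos hs0
  have g4 := Real.Gamma_pos_of_pos (by linarith : 0 < s + 5 / 2)
  have g5 := Real.Gamma_pos_of_pos (by linarith : 0 < b + 5 / 2)
  have r1 : 0 < b ^ ((5 : ℝ) / 2) := by positivity
  have r2 : 0 < s ^ ((5 : ℝ) / 2) := by positivity
  generalize Real.Gamma i = G1 at *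
  generalize Real.Gamma b = G2 at *
  generalize Real.Gamma s = G3 at *
  generalize Real.Gamma (s + 5 / 2) = G4 at *
  generalize Real.Gamma (b + 5 / 2) = G5 at *
  generalize b ^ ((5 : ℝ) / 2) = R1 at *
  generalize s ^ ((5 : ℝ) / 2) = R2 at *
  have hn1 : 0 < n + 1 := by linarith
  have hs1 : 0 < s + 1 := by linarith
  have key : i * (i + 1) / (s * (s + 1)) - 2 * (i / (n + 1)) * (i / s) + (i / (n + 1)) ^ 2 =
      (1 / (s + 1) * (i / s) * (b / s) + 25 / 4 * (i / s) ^ 2 * (1 / (n + 1)) * (1 / (n + 1))) := by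
    have hb' : b = s - i := by linarith
    subst hn
    rw [hb']
    field_simp
    ring
  trans (n * (G2 * G4 / (G3 * G5))) *
    (i * (i + 1) / (s * (s + 1)) - 2 * (i / (n + 1)) * (i / s) + (i / (n + 1)) ^ 2)
  · field_simp
  · rw [key]
    field_simp

open Topology in
lemma aux_limit {β : ℝ} (hβ : β ∈ Set.Ioo (0:ℝ) 1) {i : ℕ → ℝ}
    (hi : Tendsto (fun n : ℕ => i n / n) atTop (𝓝 β)) :
    Tendsto (fun n : ℕ => (n : ℝ) * ((betaFun (i n + 2) (n - i n - 3 / 2)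
        - 2 * (i n / (n + 1)) * betaFun (i n + 1) (n - i n - 3 / 2)
        + (i n / (n + 1)) ^ 2 * betaFun (i n) (n - i n - 3 / 2)) / betaFun (i n) (n + 1 - i n)))
      atTop (𝓝 (β * (1 - β) ^ (-(3 : ℝ) / 2))) := by
  have hβ1 : 0 < 1 - β := by linarith [hβ.2]
  have hN : Tendsto (fun n : ℕ => (n : ℝ)) atTop atTop := tendsto_natCast_atTop_atTop
  have hlin : ∀ c : ℝ, Tendsto (fun n : ℕ => ((n : ℝ) + c) / n) atTop (𝓝 1) :=
    fun c => (aux_lin c).comp hN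
  have hlin' : ∀ c : ℝ, Tendsto (fun n : ℕ => (n : ℝ) / (n + c)) atTop (𝓝 1) := fun c => by
    simpa using (hlin c).inv₀ one_ne_zero
  have hbn : Tendsto (fun n : ℕ => ((n : ℝ) - i n - 3 / 2) / n) atTop (𝓝 (1 - β)) := by
    refine ((hlin (-(3 / 2))).sub hi).congr fun n => ?_
    rw [← sub_div]; congr 1; ring
  have hs : Tendsto (fun n : ℕ => (n : ℝ) - 3 / 2) atTop atTop :=
    tendsto_atTop_add_const_right _ _ hN
  have hb : Tendsto (fun n : ℕ => (n : ℝ) - i n - 3 / 2) atTop atTop := by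
    refine (hbn.pos_mul_atTop hβ1 hN).congr' ?_
    filter_upwards [eventually_gt_atTop 0] with n hn
    have : (n : ℝ) ≠ 0 := by positivity
    field_simp
  have hipos : ∀ᶠ n : ℕ in atTop, 0 < i n := by
    filter_upwards [hi.eventually_const_lt hβ.1, eventually_gt_atTop 0] with n h hn
    have : (0 : ℝ) < n := by positivity
    exact (div_pos_iff_of_pos_right this).1 h
  have hsn : Tendsto (fun n : ℕ => (n : ℝ) / (n - 3 / 2)) atTop (𝓝 1) := by
    simpa [sub_eq_add_neg] using hlin' (-(3 / 2))
  have his : Tendsto (fun n : ℕ => i n / ((n : ℝ) - 3 / 2)) atTop (𝓝 β) := by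
    have := hi.mul hsn
    rw [mul_one] at this
    refine this.congr' ?_
    filter_upwards [eventually_gt_atTop 0] with n hn
    have : (n : ℝ) ≠ 0 := by positivity
    rw [div_mul_div_cancel₀ this]
  have hbs : Tendsto (fun n : ℕ => ((n : ℝ) - i n - 3 / 2) / ((n : ℝ) - 3 / 2))
      atTop (𝓝 (1 - β)) := by
    have := hbn.mul hsn
    rw [mul_one] at this
    refine this.congr' ?_
    filter_upwards [eventually_gt_atTop 0] with n hn
    have : (n : ℝ) ≠ 0 := by positivity
    rw [div_mul_div_cancel₀ this]
  have hns : Tendsto (fun n : ℕ => (n : ℝ) / (n - 3 / 2 + 1)) atTop (𝓝 1) := by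
    refine (hlin' (-(1 / 2))).congr fun n => ?_
    congr 1; ring
  have h0 : Tendsto (fun n : ℕ => 1 / ((n : ℝ) + 1)) atTop (𝓝 0) :=
    tendsto_one_div_add_atTop_nhds_zero_nat
  have hpow := (hbs.rpow_const (p := (5 : ℝ) / 2) (Or.inl hβ1.ne')).inv₀
    (by positivity)
  have hmain := (((aux_H.comp hs).div (aux_H.comp hb) one_ne_zero).mul hpow).mul
    (((hns.mul his).mul hbs).add ((((his.pow 2).const_mul (25 / 4)).mul (hlin' 1)).mul h0))
  have hc : (1 : ℝ) / 1 * ((1 - β) ^ ((5 : ℝ) / 2))⁻¹ *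
      (1 * β * (1 - β) + 25 / 4 * β ^ 2 * 1 * 0) = β * (1 - β) ^ (-(3 : ℝ) / 2) := by
    have : (1 - β) ^ (-(3 : ℝ) / 2) = ((1 - β) ^ ((5 : ℝ) / 2))⁻¹ * (1 - β) := by
      rw [← Real.rpow_neg hβ1.le, ← Real.rpow_add_one hβ1.ne']; congr 1; norm_num
    rw [this]; ring
  rw [hc] at hmain
  refine hmain.congr' ?_
  filter_upwards [hipos, hb.eventually_gt_atTop 0] with n h1 h2
  have := aux_formula (n := n) (s := n - 3 / 2) h1 h2 (by ring) (by ring)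
  have e : (n : ℝ) - i n - 3 / 2 + 5 / 2 = n + 1 - i n := by ring
  rw [e] at this
  rw [this]
  simp only [Pi.div_apply, Function.comp_apply, e]

/-- For `i ≤ n - 3`, the moment `E[(U_{(i)} - i/(n+1))²/(1-U_{(i)})^{5/2}]` of the
`i`-th uniform order statistic is finite, is given by a ratio of Beta functions, and
is asymptotically `n⁻¹(i/(n+1))(1 - i/(n+1))^{-3/2}` for `i = ⌊nβ⌋`. -/
theorem orderStat_moment_beta (β : ℝ) (hβ : β ∈ Set.Ioo (0:ℝ) 1) :
    (∀ i n : ℕ, 1 ≤ i → i ≤ n - 3 → 3 ≤ n →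
      IntegrableOn (fun x : ℝ =>
        x ^ ((i : ℝ) - 1) * (1 - x) ^ ((n : ℝ) - i) *
          (x - (i : ℝ) / ((n : ℝ) + 1)) ^ 2 / (1 - x) ^ ((5 : ℝ) / 2))
        (Set.Ioo 0 1) volume) ∧
    (∀ i n : ℕ, 1 ≤ i → i ≤ n - 3 → 3 ≤ n →
      orderStatMoment i n =
        (betaFun ((i : ℝ) + 2) ((n : ℝ) - i - 3 / 2)
            - 2 * ((i : ℝ) / ((n : ℝ) + 1)) * betaFun ((i : ℝ) + 1) ((n : ℝ) - i - 3 / 2)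
            + ((i : ℝ) / ((n : ℝ) + 1)) ^ 2 * betaFun i ((n : ℝ) - i - 3 / 2)) /
          betaFun i ((n : ℝ) + 1 - i)) ∧
    (fun n : ℕ => orderStatMoment ⌊(n : ℝ) * β⌋₊ n) ~[atTop]
      (fun n : ℕ => (n : ℝ)⁻¹ * ((⌊(n : ℝ) * β⌋₊ : ℝ) / ((n : ℝ) + 1)) *
        (1 - (⌊(n : ℝ) * β⌋₊ : ℝ) / ((n : ℝ) + 1)) ^ (-(3 : ℝ) / 2)) := by
  have real_hyp : ∀ i n : ℕ, 1 ≤ i → i ≤ n - 3 → 3 ≤ n →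
      (0 : ℝ) < i ∧ (0 : ℝ) < (n : ℝ) - i - 3 / 2 := by
    intro i n h1 h2 h3
    have h4 : i + 3 ≤ n := by omega
    have h4' : (i : ℝ) + 3 ≤ n := by exact_mod_cast h4
    exact ⟨by exact_mod_cast h1, by linarith⟩
  have formula : ∀ i n : ℕ, 1 ≤ i → i ≤ n - 3 → 3 ≤ n →
      orderStatMoment i n =
        (betaFun ((i : ℝ) + 2) ((n : ℝ) - i - 3 / 2)
            - 2 * ((i : ℝ) / ((n : ℝ) + 1)) * betaFun ((i : ℝ) + 1) ((n : ℝ) - i - 3 / 2)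
            + ((i : ℝ) / ((n : ℝ) + 1)) ^ 2 * betaFun i ((n : ℝ) - i - 3 / 2)) /
          betaFun i ((n : ℝ) + 1 - i) := by
    intro i n h1 h2 h3
    obtain ⟨hi, hn⟩ := real_hyp i n h1 h2 h3
    rw [orderStatMoment, (aux_int _ hi hn).2]
  refine ⟨fun i n h1 h2 h3 => ?_, formula, ?_⟩
  · obtain ⟨hi, hn⟩ := real_hyp i n h1 h2 h3
    exact (aux_int _ hi hn).1
  have hβ1 : 0 < 1 - β := by linarith [hβ.2]
  have hN : Tendsto (fun n : ℕ => (n : ℝ)) atTop atTop := tendsto_natCast_atTop_atTop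
  have hi : Tendsto (fun n : ℕ => (⌊(n : ℝ) * β⌋₊ : ℝ) / n) atTop (nhds β) := by
    refine ((tendsto_nat_floor_mul_div_atTop hβ.1.le).comp hN).congr fun n => ?_
    simp only [Function.comp_apply, mul_comm]
  have hp : Tendsto (fun n : ℕ => (⌊(n : ℝ) * β⌋₊ : ℝ) / ((n : ℝ) + 1)) atTop (nhds β) := by
    have h1 : Tendsto (fun n : ℕ => (n : ℝ) / (n + 1)) atTop (nhds 1) := by
      simpa using ((aux_lin 1).comp hN).inv₀ one_ne_zero
    have := hi.mul h1
    rw [mul_one] at this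
    refine this.congr' ?_
    filter_upwards [eventually_gt_atTop 0] with n hn
    have : (n : ℝ) ≠ 0 := by positivity
    rw [div_mul_div_cancel₀ this]
  have hc : β * (1 - β) ^ (-(3 : ℝ) / 2) ≠ 0 :=
    (mul_pos hβ.1 (Real.rpow_pos_of_pos hβ1 _)).ne'
  refine aux_equiv hc ((aux_limit hβ hi).congr' ?_) ?_
  · filter_upwards [hN.eventually_ge_atTop (1 / β), hN.eventually_ge_atTop (3 / (1 - β)),
      eventually_ge_atTop 3] with n h1 h2 h3
    rw [div_le_iff₀ hβ.1] at h1
    rw [div_le_iff₀ hβ1] at h2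
    have hle : (⌊(n : ℝ) * β⌋₊ : ℝ) ≤ n * β :=
      Nat.floor_le (mul_nonneg (Nat.cast_nonneg n) hβ.1.le)
    have h4 : ⌊(n : ℝ) * β⌋₊ + 3 ≤ n := by
      have : (⌊(n : ℝ) * β⌋₊ : ℝ) + 3 ≤ n := by nlinarith
      exact_mod_cast this
    rw [formula _ n (Nat.le_floor (by simpa using h1)) (by omega) h3]
  · have := hp.mul ((tendsto_const_nhds (x := (1 : ℝ))).sub hp |>.rpow_const
      (p := -(3 : ℝ) / 2) (Or.inl hβ1.ne'))
    refine this.congr' ?_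
    filter_upwards [eventually_gt_atTop 0] with n hn
    have : (n : ℝ) ≠ 0 := by positivity
    rw [mul_assoc, mul_inv_cancel_left₀ this]
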